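/- For all real α > -1, -1 < β ≤ 0, and every real p > 0, the Mellin transform 𝓜_{u_p}(η) = ∫₀¹ (h(1)-h(r))^p·r^{η-1} dr satisfies lim_{η→+∞} η^{p(α+1)+1}·𝓜_{u_p}(η) = Γ(p(α+1)+1)/(α+1)^p, where the limit is taken over real η → +∞. -/

import Mathlib

open MeasureTheory Real Filter

/-- The incomplete beta function h(r) = ∫₀^r t^β (1-t)^α dt. -/
noncomputable def hfun (α β : ℝ) (r : ℝ) : ℝ := ∫ t in (0:ℝ)..r, t ^ β * (1 - t) ^ α

lemma intervalIntegrable_one_sub_rpow {α : ℝ} (hα : -1 < α) (a b : ℝ) :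
    IntervalIntegrable (fun t : ℝ => (1 - t) ^ α) volume a b := by
  have h := (intervalIntegral.intervalIntegrable_rpow' (a := 1 - a) (b := 1 - b) hα).comp_sub_left 1
  simpa using h

lemma integral_one_sub_rpow {α : ℝ} (hα : -1 < α) (r : ℝ) :
    ∫ t in r..1, (1 - t) ^ α = (1 - r) ^ (α + 1) / (α + 1) := by
  rw [intervalIntegral.integral_comp_sub_left (fun t : ℝ => t ^ α) 1, sub_self,
    integral_rpow (Or.inl hα), zero_rpow (by linarith), sub_zero]

lemma intervalIntegrable_beta_integrand {α β : ℝ} (hα : -1 < α) (hβ : -1 < β) :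
    IntervalIntegrable (fun t : ℝ => t ^ β * (1 - t) ^ α) volume 0 1 := by
  refine IntervalIntegrable.trans (b := 1 / 2) ?_ ?_
  · refine (intervalIntegral.intervalIntegrable_rpow' hβ).mul_continuousOn ?_
    refine ContinuousOn.rpow_const (by fun_prop) fun x hx => Or.inl ?_
    rw [Set.uIcc_of_le (by norm_num)] at hx
    linarith [hx.2]
  · refine (intervalIntegrable_one_sub_rpow hα _ _).continuousOn_mul ?_
    refine ContinuousOn.rpow_const (by fun_prop) fun x hx => Or.inl ?_
    rw [Set.uIcc_of_le (by norm_num)] at hx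
    linarith [hx.1]

lemma intervalIntegrable_beta_integrand_of_mem {α β r : ℝ} (hα : -1 < α) (hβ : -1 < β)
    (hr : r ∈ Set.Icc (0 : ℝ) 1) :
    IntervalIntegrable (fun t : ℝ => t ^ β * (1 - t) ^ α) volume r 1 :=
  (intervalIntegrable_beta_integrand hα hβ).mono_set <| by
    rw [Set.uIcc_of_le hr.2, Set.uIcc_of_le zero_le_one]
    exact Set.Icc_subset_Icc_left hr.1

lemma hfun_one_sub {α β r : ℝ} (hα : -1 < α) (hβ : -1 < β) (hr : r ∈ Set.Icc (0 : ℝ) 1) :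
    hfun α β 1 - hfun α β r = ∫ t in r..1, t ^ β * (1 - t) ^ α := by
  have h := intervalIntegrable_beta_integrand hα hβ
  exact intervalIntegral.integral_interval_sub_left h
    (h.trans (intervalIntegrable_beta_integrand_of_mem hα hβ hr).symm)

lemma continuousOn_hfun {α β : ℝ} (hα : -1 < α) (hβ : -1 < β) :
    ContinuousOn (hfun α β) (Set.Icc 0 1) := by
  have h := intervalIntegral.continuousOn_primitive_interval'
    (intervalIntegrable_beta_integrand hα hβ) Set.left_mem_uIcc
  rwa [Set.uIcc_of_le zero_le_one] at h

lemma le_hfun_one_sub {α β r : ℝ} (hα : -1 < α) (hβ : -1 < β) (hβ' : β ≤ 0)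
    (hr : r ∈ Set.Icc (0 : ℝ) 1) :
    (1 - r) ^ (α + 1) / (α + 1) ≤ hfun α β 1 - hfun α β r := by
  rw [hfun_one_sub hα hβ hr, ← integral_one_sub_rpow hα]
  refine intervalIntegral.integral_mono_on_of_le_Ioo hr.2 (intervalIntegrable_one_sub_rpow hα _ _)
    (intervalIntegrable_beta_integrand_of_mem hα hβ hr) fun t ht => ?_
  exact le_mul_of_one_le_left (rpow_nonneg (by linarith [ht.2]) _)
    (one_le_rpow_of_pos_of_le_one_of_nonpos (hr.1.trans_lt ht.1) ht.2.le hβ')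

lemma hfun_one_sub_le {α β r : ℝ} (hα : -1 < α) (hβ : -1 < β) (hβ' : β ≤ 0)
    (hr : r ∈ Set.Ioc (0 : ℝ) 1) :
    hfun α β 1 - hfun α β r ≤ r ^ β * ((1 - r) ^ (α + 1) / (α + 1)) := by
  have hr' := Set.Ioc_subset_Icc_self hr
  rw [hfun_one_sub hα hβ hr', ← integral_one_sub_rpow hα, ← intervalIntegral.integral_const_mul]
  refine intervalIntegral.integral_mono_on_of_le_Ioo hr.2
    (intervalIntegrable_beta_integrand_of_mem hα hβ hr')
    ((intervalIntegrable_one_sub_rpow hα _ _).const_mul _) fun t ht => ?_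
  exact mul_le_mul_of_nonneg_right (rpow_le_rpow_of_nonpos hr.1 ht.1.le hβ')
    (rpow_nonneg (by linarith [ht.2]) _)

lemma hfun_one_sub_nonneg {α β r : ℝ} (hα : -1 < α) (hβ : -1 < β) (hβ' : β ≤ 0)
    (hr : r ∈ Set.Icc (0 : ℝ) 1) : 0 ≤ hfun α β 1 - hfun α β r :=
  (div_nonneg (rpow_nonneg (by linarith [hr.2]) _) (by linarith)).trans
    (le_hfun_one_sub hα hβ hβ' hr)

lemma exists_hfun_one_sub_le {α β : ℝ} (hα : -1 < α) (hβ : -1 < β) (hβ' : β ≤ 0) :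
    ∃ C : ℝ, 0 ≤ C ∧ ∀ r ∈ Set.Icc (0 : ℝ) 1,
      hfun α β 1 - hfun α β r ≤ C * (1 - r) ^ (α + 1) := by
  obtain ⟨M, hM⟩ := isCompact_Icc.exists_bound_of_continuousOn
    ((continuousOn_const (c := hfun α β 1)).sub (continuousOn_hfun hα hβ))
  have hM0 : 0 ≤ M := (norm_nonneg _).trans (hM 0 (by simp))
  have hα' : 0 < α + 1 := by linarith
  refine ⟨max (M * 2 ^ (α + 1)) ((1 / 2) ^ β / (α + 1)), le_max_of_le_left (by positivity),
    fun r hr => ?_⟩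
  have h1r : 0 ≤ 1 - r := by linarith [hr.2]
  have hpow : 0 ≤ (1 - r) ^ (α + 1) := rpow_nonneg h1r _
  rcases le_total r (1 / 2) with h | h
  · refine ((le_abs_self _).trans (hM r hr)).trans
      (le_trans ?_ (mul_le_mul_of_nonneg_right (le_max_left _ _) hpow))
    rw [mul_assoc, ← mul_rpow zero_le_two h1r]
    exact le_mul_of_one_le_right hM0 (one_le_rpow (by linarith) hα'.le)
  · refine (hfun_one_sub_le hα hβ hβ' ⟨by linarith, hr.2⟩).trans
      (le_trans ?_ (mul_le_mul_of_nonneg_right (le_max_right _ _) hpow))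
    rw [div_mul_eq_mul_div, ← mul_div_assoc]
    gcongr ?_ * _ / _
    exact rpow_le_rpow_of_nonpos (by norm_num) h hβ'

lemma tendsto_one_sub_div_atTop (s : ℝ) :
    Tendsto (fun η : ℝ => 1 - s / η) atTop (nhds 1) := by
  simpa using (tendsto_const_nhds (x := (1 : ℝ))).sub (tendsto_id.const_div_atTop s)

lemma tendsto_one_sub_div_rpow_exp_neg (s : ℝ) :
    Tendsto (fun η : ℝ => (1 - s / η) ^ (η - 1)) atTop (nhds (exp (-s))) := by
  have h := (tendsto_one_add_div_rpow_exp (-s)).div (tendsto_one_sub_div_atTop s) one_ne_zero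
  rw [div_one] at h
  refine h.congr' ?_
  filter_upwards [(tendsto_one_sub_div_atTop s).eventually (lt_mem_nhds zero_lt_one)] with η hη
  simp only [Pi.div_apply]
  rw [rpow_sub_one hη.ne', neg_div, ← sub_eq_add_neg]

lemma one_sub_div_mem_Icc {s η : ℝ} (hη : 0 < η) (hs : 0 ≤ s) (hsη : s ≤ η) :
    1 - s / η ∈ Set.Icc (0 : ℝ) 1 :=
  ⟨by linarith [(div_le_one hη).2 hsη], by linarith [div_nonneg hs hη.le]⟩

lemma tendsto_rpow_mul_hfun_one_sub {α β s : ℝ} (hα : -1 < α) (hβ : -1 < β) (hβ' : β ≤ 0)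
    (hs : 0 < s) :
    Tendsto (fun η : ℝ => η ^ (α + 1) * (hfun α β 1 - hfun α β (1 - s / η))) atTop
      (nhds (s ^ (α + 1) / (α + 1))) := by
  have hscale {η : ℝ} (hη : 0 < η) : η ^ (α + 1) * ((1 - (1 - s / η)) ^ (α + 1) / (α + 1)) =
      s ^ (α + 1) / (α + 1) := by
    rw [sub_sub_cancel, ← mul_div_assoc, ← mul_rpow hη.le (by positivity), mul_div_cancel₀ _ hη.ne']
  have hup : Tendsto (fun η : ℝ => (1 - s / η) ^ β * (s ^ (α + 1) / (α + 1))) atTop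
      (nhds (s ^ (α + 1) / (α + 1))) := by
    simpa using ((tendsto_one_sub_div_atTop s).rpow_const (p := β)
      (Or.inl one_ne_zero)).mul_const (s ^ (α + 1) / (α + 1))
  refine tendsto_of_tendsto_of_tendsto_of_le_of_le' tendsto_const_nhds hup ?_ ?_
  · filter_upwards [eventually_ge_atTop s] with η hη
    have hη0 := hs.trans_le hη
    rw [← hscale hη0]
    exact mul_le_mul_of_nonneg_left
      (le_hfun_one_sub hα hβ hβ' (one_sub_div_mem_Icc hη0 hs.le hη)) (by positivity)
  · filter_upwards [eventually_gt_atTop s] with η hη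
    have hη0 := hs.trans hη
    rw [← hscale hη0, mul_left_comm]
    exact mul_le_mul_of_nonneg_left (hfun_one_sub_le hα hβ hβ'
      ⟨by linarith [(div_lt_one hη0).2 hη], (one_sub_div_mem_Icc hη0 hs.le hη.le).2⟩)
      (by positivity)

lemma one_sub_div_rpow_le_exp {s η : ℝ} (hη : 2 ≤ η) (hs : 0 ≤ s) (hsη : s ≤ η) :
    (1 - s / η) ^ (η - 1) ≤ exp (-(1 / 2) * s) := by
  have hη0 : 0 < η := by linarith
  calc (1 - s / η) ^ (η - 1) ≤ exp (-(s / η)) ^ (η - 1) :=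
        rpow_le_rpow (one_sub_div_mem_Icc hη0 hs hsη).1 (one_sub_le_exp_neg _) (by linarith)
    _ = exp (-(s / η) * (η - 1)) := (exp_mul _ _).symm
    _ ≤ exp (-(1 / 2) * s) := by
        refine exp_le_exp.2 ?_
        have : s / η ≤ s / 2 := by gcongr
        have h2 : s / η * η = s := div_mul_cancel₀ _ hη0.ne'
        linarith

/-- The integrand of the Mellin transform after the substitution `r = 1 - s / η`. -/
noncomputable def scaledIntegrand (α β p η s : ℝ) : ℝ :=
  (η ^ (α + 1) * (hfun α β 1 - hfun α β (1 - s / η))) ^ p * (1 - s / η) ^ (η - 1)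

lemma rpow_mul_mellin_eq {α β p η : ℝ} (hα : -1 < α) (hβ : -1 < β) (hβ' : β ≤ 0)
    (hη : 0 < η) :
    η ^ (p * (α + 1) + 1) * ∫ r in (0:ℝ)..1, (hfun α β 1 - hfun α β r) ^ p * r ^ (η - 1) =
      ∫ s in Set.Ioi (0 : ℝ), (Set.Ioc 0 η).indicator (scaledIntegrand α β p η) s := by
  have hsub := intervalIntegral.integral_comp_sub_div (a := 0) (b := η)
    (fun r => (hfun α β 1 - hfun α β r) ^ p * r ^ (η - 1)) hη.ne' 1
  rw [div_self hη.ne', sub_self, zero_div, sub_zero, smul_eq_mul] at hsub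
  rw [rpow_add_one hη.ne', mul_assoc, ← hsub, ← intervalIntegral.integral_const_mul,
    setIntegral_indicator measurableSet_Ioc, Set.inter_eq_right.2 Set.Ioc_subset_Ioi_self,
    intervalIntegral.integral_of_le hη.le]
  refine setIntegral_congr_fun measurableSet_Ioc fun s hs => ?_
  simp only [scaledIntegrand]
  rw [mul_rpow (by positivity) (hfun_one_sub_nonneg hα hβ hβ'
    (one_sub_div_mem_Icc hη hs.1.le hs.2)), ← rpow_mul hη.le, mul_comm p, mul_assoc]

lemma continuousOn_scaledIntegrand {α β p η : ℝ} (hα : -1 < α) (hβ : -1 < β) (hp : 0 < p)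
    (hη : 1 ≤ η) : ContinuousOn (scaledIntegrand α β p η) (Set.Ioc 0 η) := by
  have hη0 : 0 < η := by linarith
  have hh : ContinuousOn (fun s => hfun α β (1 - s / η)) (Set.Ioc 0 η) :=
    (continuousOn_hfun hα hβ).comp (by fun_prop)
      fun s hs => one_sub_div_mem_Icc hη0 hs.1.le hs.2
  refine ContinuousOn.mul ?_ ?_
  · exact (continuousOn_const.mul (continuousOn_const.sub hh)).rpow_const fun _ _ => Or.inr hp.le
  · exact ContinuousOn.rpow_const (by fun_prop) fun _ _ => Or.inr (by linarith)

lemma norm_scaledIntegrand_le {α β p η s C : ℝ} (hα : -1 < α) (hβ : -1 < β) (hβ' : β ≤ 0)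
    (hp : 0 < p) (hC : 0 ≤ C)
    (hCr : ∀ r ∈ Set.Icc (0 : ℝ) 1, hfun α β 1 - hfun α β r ≤ C * (1 - r) ^ (α + 1))
    (hη : 2 ≤ η) (hs : 0 ≤ s) (hsη : s ≤ η) :
    ‖scaledIntegrand α β p η s‖ ≤ C ^ p * (s ^ (p * (α + 1)) * exp (-(1 / 2) * s)) := by
  have hη0 : 0 < η := by linarith
  have hmem := one_sub_div_mem_Icc hη0 hs hsη
  have hu : 0 ≤ η ^ (α + 1) * (hfun α β 1 - hfun α β (1 - s / η)) :=
    mul_nonneg (by positivity) (hfun_one_sub_nonneg hα hβ hβ' hmem)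
  have hle : η ^ (α + 1) * (hfun α β 1 - hfun α β (1 - s / η)) ≤ C * s ^ (α + 1) := by
    calc _ ≤ η ^ (α + 1) * (C * (1 - (1 - s / η)) ^ (α + 1)) :=
          mul_le_mul_of_nonneg_left (hCr _ hmem) (by positivity)
      _ = C * s ^ (α + 1) := by
          rw [sub_sub_cancel, mul_left_comm, ← mul_rpow hη0.le (by positivity),
            mul_div_cancel₀ _ hη0.ne']
  have hpow := rpow_nonneg hmem.1 (η - 1)
  rw [scaledIntegrand, Real.norm_of_nonneg (mul_nonneg (rpow_nonneg hu _) hpow), mul_comm p,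
    rpow_mul hs, ← mul_assoc, ← mul_rpow hC (by positivity)]
  exact mul_le_mul (rpow_le_rpow hu hle hp.le) (one_sub_div_rpow_le_exp hη hs hsη) hpow
    (by positivity)

lemma tendsto_scaledIntegrand {α β p s : ℝ} (hα : -1 < α) (hβ : -1 < β) (hβ' : β ≤ 0)
    (hp : 0 < p) (hs : 0 < s) :
    Tendsto (fun η => scaledIntegrand α β p η s) atTop
      (nhds ((s ^ (α + 1) / (α + 1)) ^ p * exp (-s))) :=
  ((tendsto_rpow_mul_hfun_one_sub hα hβ hβ' hs).rpow_const (Or.inr hp.le)).mul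
    (tendsto_one_sub_div_rpow_exp_neg s)

lemma integral_Ioi_eq_Gamma_div {α p : ℝ} (hα : -1 < α) (hp : 0 < p) :
    ∫ s in Set.Ioi (0 : ℝ), (s ^ (α + 1) / (α + 1)) ^ p * exp (-s) =
      Real.Gamma (p * (α + 1) + 1) / (α + 1) ^ p := by
  have hα' : 0 < α + 1 := by linarith
  rw [Real.Gamma_eq_integral (by positivity), ← integral_div]
  refine setIntegral_congr_fun measurableSet_Ioi fun s hs => ?_
  have hs' : 0 ≤ s := le_of_lt hs
  rw [div_rpow (by positivity) hα'.le, ← rpow_mul hs', add_sub_cancel_right, mul_comm p]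
  ring

/-- The Mellin transform of (h(1)-h(r))^p satisfies
lim_{η→∞} η^{p(α+1)+1}·𝓜(η) = Γ(p(α+1)+1)/(α+1)^p. -/
theorem mellin_asymptotics (α β p : ℝ) (hα : -1 < α) (hβ1 : -1 < β) (hβ2 : β ≤ 0)
    (hp : 0 < p) :
    Tendsto (fun η : ℝ => η ^ (p * (α + 1) + 1) *
        ∫ r in (0:ℝ)..1, (hfun α β 1 - hfun α β r) ^ p * r ^ (η - 1))
      atTop (nhds (Real.Gamma (p * (α + 1) + 1) / (α + 1) ^ p)) := by
  obtain ⟨C, hC, hCr⟩ := exists_hfun_one_sub_le hα hβ1 hβ2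
  rw [← integral_Ioi_eq_Gamma_div hα hp]
  have hlim : Tendsto (fun η : ℝ => ∫ s in Set.Ioi (0 : ℝ),
      (Set.Ioc 0 η).indicator (scaledIntegrand α β p η) s) atTop
      (nhds (∫ s in Set.Ioi (0 : ℝ), (s ^ (α + 1) / (α + 1)) ^ p * exp (-s))) := by
    refine tendsto_integral_filter_of_dominated_convergence
      (fun s => C ^ p * (s ^ (p * (α + 1)) * exp (-(1 / 2) * s))) ?_ ?_ ?_ ?_
    · filter_upwards [eventually_ge_atTop 1] with η hη
      refine AEStronglyMeasurable.restrict ?_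
      exact (aestronglyMeasurable_indicator_iff measurableSet_Ioc).2
        ((continuousOn_scaledIntegrand hα hβ1 hp hη).aestronglyMeasurable measurableSet_Ioc)
    · filter_upwards [eventually_ge_atTop 2] with η hη
      filter_upwards [ae_restrict_mem measurableSet_Ioi] with s hs
      have hs' : 0 < s := hs
      by_cases hsη : s ≤ η
      · rw [Set.indicator_of_mem (Set.mem_Ioc.2 ⟨hs', hsη⟩)]
        exact norm_scaledIntegrand_le hα hβ1 hβ2 hp hC hCr hη hs'.le hsη
      · rw [Set.indicator_of_notMem fun h => hsη h.2, norm_zero]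
        positivity
    · have hexp : -1 < p * (α + 1) := by
        linarith [mul_pos hp (show 0 < α + 1 by linarith)]
      have h := integrableOn_rpow_mul_exp_neg_mul_rpow hexp one_pos (one_half_pos (α := ℝ))
      simp only [rpow_one] at h
      exact h.const_mul _
    · filter_upwards [ae_restrict_mem measurableSet_Ioi] with s hs
      refine (tendsto_scaledIntegrand hα hβ1 hβ2 hp hs).congr' ?_
      filter_upwards [eventually_ge_atTop s] with η hη
      exact (Set.indicator_of_mem (Set.mem_Ioc.2 ⟨hs, hη⟩) _).symm
  refine hlim.congr' ?_
  filter_upwards [eventually_gt_atTop 0] with η hη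
  exact (rpow_mul_mellin_eq hα hβ1 hβ2 hη).symm
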